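/- arXiv:1509.02212 — 3 statements merged into one kernel-verified Lean document; each statement's English description precedes it below -/
import Mathlib

section
/- Let G be a group, let Γ be a group acting on G by automorphisms, and let U₁ and U₂ be Γ-stable subgroups of G. Suppose that for every g ∈ G the first nonabelian cohomology of Γ with coefficients in gU₁g⁻¹ ∩ U₂ is trivial, i.e. every map c : Γ → gU₁g⁻¹ ∩ U₂ satisfying c(γδ) = c(γ)·γ(c(δ)) for all γ, δ ∈ Γ is of the form c(γ) = u⁻¹·γ(u) for some u ∈ gU₁g⁻¹ ∩ U₂. Then for every g ∈ G fixed by every element of Γ, the set of Γ-fixed points of the double coset U₁gU₂ equals U₁^Γ g U₂^Γ, where U_i^Γ denotes the subgroup of Γ-fixed elements of U_i. -/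
/-- Let `Γ` act on a group `G` by automorphisms, and let `U₁`, `U₂` be
`Γ`-stable subgroups.  If for every `g ∈ G` the first nonabelian cohomology of `Γ` with
coefficients in `gU₁g⁻¹ ∩ U₂` is trivial (every cocycle is a coboundary), then for every
`Γ`-fixed `g ∈ G` the `Γ`-fixed points of the double coset `U₁gU₂` are exactly
`U₁^Γ g U₂^Γ`. -/
theorem fixed_points_of_double_coset
    {G Γ : Type*} [Group G] [Group Γ] (φ : Γ →* MulAut G)
    (U₁ U₂ : Subgroup G)
    (hU₁ : ∀ γ : Γ, ∀ u : G, u ∈ U₁ ↔ φ γ u ∈ U₁)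
    (hU₂ : ∀ γ : Γ, ∀ u : G, u ∈ U₂ ↔ φ γ u ∈ U₂)
    (hcoh : ∀ g : G, ∀ c : Γ → G,
      (∀ γ : Γ, c γ ∈ U₂ ∧ ∃ u ∈ U₁, c γ = g * u * g⁻¹) →
      (∀ γ δ : Γ, c (γ * δ) = c γ * φ γ (c δ)) →
      ∃ u : G, (u ∈ U₂ ∧ ∃ v ∈ U₁, u = g * v * g⁻¹) ∧ ∀ γ : Γ, c γ = u⁻¹ * φ γ u)
    (g : G) (hg : ∀ γ : Γ, φ γ g = g) :
    {x : G | (∃ u₁ ∈ U₁, ∃ u₂ ∈ U₂, x = u₁ * g * u₂) ∧ ∀ γ : Γ, φ γ x = x} =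
      {x : G | ∃ u₁ ∈ U₁, (∀ γ : Γ, φ γ u₁ = u₁) ∧
        ∃ u₂ ∈ U₂, (∀ γ : Γ, φ γ u₂ = u₂) ∧ x = u₁ * g * u₂} := by
  ext x
  constructor
  · rintro ⟨⟨u₁, h₁, u₂, h₂, rfl⟩, hx⟩
    have hx' (γ : Γ) : φ γ u₁ * g * φ γ u₂ = u₁ * g * u₂ := by
      simpa [hg γ] using hx γ
    obtain ⟨u, ⟨hu, v, hv, huv⟩, hc⟩ := hcoh g⁻¹ (fun γ => u₂ * (φ γ u₂)⁻¹)
      (fun γ => ⟨mul_mem h₂ (inv_mem ((hU₂ γ u₂).1 h₂)), u₁⁻¹ * φ γ u₁,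
        mul_mem (inv_mem h₁) ((hU₁ γ u₁).1 h₁), by
          rw [mul_inv_eq_iff_eq_mul, inv_inv]
          calc u₂ = g⁻¹ * u₁⁻¹ * (u₁ * g * u₂) := by group
            _ = g⁻¹ * u₁⁻¹ * (φ γ u₁ * g * φ γ u₂) := by rw [hx']
            _ = _ := by group⟩)
      (fun γ δ => by simp)
    have hfix (γ : Γ) : φ γ (u * u₂) = u * u₂ := by
      have h : u₂ * (φ γ u₂)⁻¹ = u⁻¹ * φ γ u := hc γ
      rw [map_mul, eq_mul_of_inv_mul_eq h.symm]
      group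
    have hv_eq : u₁ * v⁻¹ = u₁ * g * u₂ * (u * u₂)⁻¹ * g⁻¹ := by
      rw [huv]
      group
    refine ⟨u₁ * v⁻¹, mul_mem h₁ (inv_mem hv), fun γ => ?_, u * u₂, mul_mem hu h₂, hfix, ?_⟩
    · rw [hv_eq, map_mul, map_mul, map_inv, map_inv, hx, hfix, hg]
    · rw [huv]
      group
  · rintro ⟨u₁, h₁, hf₁, u₂, h₂, hf₂, rfl⟩
    exact ⟨⟨u₁, h₁, u₂, h₂, rfl⟩, fun γ => by rw [map_mul, map_mul, hf₁, hg, hf₂]⟩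
end

section
/- Let R be a field and G a group. Let X₁ and X₂ be subgroups of G and, for i = 1, 2, let X_i¹ be a subgroup of X_i. For i = 1, 2, let (μ_i, V_i) and (ζ_i, W_i) be finite-dimensional R-linear representations of X_i, and assume ζ_i is trivial on X_i¹. Suppose that the intertwining space Hom_{X₁∩X₂}(μ₁, μ₂) is equal (as a subspace of the space of all R-linear maps V₁ → V₂) to Hom_{X₁¹∩X₂¹}(μ₁, μ₂), and that this space is one-dimensional over R. Then for any nonzero S ∈ Hom_{X₁∩X₂}(μ₁, μ₂), the map T ↦ S ⊗ T is an R-linear isomorphism from Hom_{X₁∩X₂}(ζ₁, ζ₂) onto Hom_{X₁∩X₂}(μ₁ ⊗ ζ₁, μ₂ ⊗ ζ₂). -/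
open TensorProduct

/-- The space of intertwining operators between (the restrictions to a subset `Y` of)
representations `μ₁` of `X₁` and `μ₂` of `X₂`. -/
def intertwiners {R G : Type*} [Field R] [Group G]
    {V₁ V₂ : Type*} [AddCommGroup V₁] [Module R V₁] [AddCommGroup V₂] [Module R V₂]
    {X₁ X₂ : Subgroup G}
    (μ₁ : Representation R (↥X₁) V₁) (μ₂ : Representation R (↥X₂) V₂)
    (Y : Set G) (hY₁ : Y ⊆ (X₁ : Set G)) (hY₂ : Y ⊆ (X₂ : Set G)) :
    Set (V₁ →ₗ[R] V₂) :=
  {f : V₁ →ₗ[R] V₂ | ∀ x (hx : x ∈ Y), f ∘ₗ μ₁ ⟨x, hY₁ hx⟩ = μ₂ ⟨x, hY₂ hx⟩ ∘ₗ f}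

/-- Over a field, tensoring with a nonzero linear map is injective. -/
theorem tensorMap_right_injective {R V₁ V₂ W₁ W₂ : Type*} [Field R]
    [AddCommGroup V₁] [Module R V₁] [AddCommGroup V₂] [Module R V₂]
    [AddCommGroup W₁] [Module R W₁] [AddCommGroup W₂] [Module R W₂]
    {S : V₁ →ₗ[R] V₂} (hS : S ≠ 0) :
    Function.Injective (fun T : W₁ →ₗ[R] W₂ => TensorProduct.map S T) := by
  intro T T' h
  obtain ⟨v, hv⟩ := DFunLike.ne_iff.mp hS
  obtain ⟨ψ, hψ⟩ := Module.Projective.exists_dual_ne_zero R hv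
  ext w
  have key := congrArg (fun F => TensorProduct.lid R W₂ (ψ.rTensor W₂ (F (v ⊗ₜ[R] w)))) h
  simpa [hψ] using key

/-- Elements of a tensor product over a field are separated by contractions of the right factor. -/
theorem tensor_ext_of_lTensor_dual {R V W : Type*} [Field R]
    [AddCommGroup V] [Module R V] [AddCommGroup W] [Module R W] [FiniteDimensional R W]
    {s t : V ⊗[R] W} (h : ∀ φ : Module.Dual R W, φ.lTensor V s = φ.lTensor V t) : s = t := by
  let b := Module.finBasis R W
  have expand : ∀ u : V ⊗[R] W,
      u = ∑ i, TensorProduct.rid R V ((b.coord i).lTensor V u) ⊗ₜ[R] b i := by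
    intro u
    induction u with
    | zero => simp
    | tmul v w =>
      conv_lhs => rw [← b.sum_repr w]
      simp only [TensorProduct.tmul_sum, TensorProduct.tmul_smul, LinearMap.lTensor_tmul,
        Module.Basis.coord_apply, TensorProduct.rid_tmul, TensorProduct.smul_tmul']
    | add x y hx hy =>
      conv_lhs => rw [hx, hy]
      simp [TensorProduct.add_tmul, Finset.sum_add_distrib]
  rw [expand s, expand t]
  simp only [h]

/-- The linear map `V₁ → V₂` obtained from `F : V₁ ⊗ W₁ → V₂ ⊗ W₂` by inserting `w` and
contracting with `φ`. -/
noncomputable def tensorContract {R V₁ V₂ W₁ W₂ : Type*} [Field R]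
    [AddCommGroup V₁] [Module R V₁] [AddCommGroup V₂] [Module R V₂]
    [AddCommGroup W₁] [Module R W₁] [AddCommGroup W₂] [Module R W₂]
    (F : V₁ ⊗[R] W₁ →ₗ[R] V₂ ⊗[R] W₂) (w : W₁) (φ : Module.Dual R W₂) : V₁ →ₗ[R] V₂ :=
  (TensorProduct.rid R V₂).toLinearMap ∘ₗ φ.lTensor V₂ ∘ₗ F ∘ₗ (TensorProduct.mk R V₁ W₁).flip w

theorem tensorContract_apply {R V₁ V₂ W₁ W₂ : Type*} [Field R]
    [AddCommGroup V₁] [Module R V₁] [AddCommGroup V₂] [Module R V₂]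
    [AddCommGroup W₁] [Module R W₁] [AddCommGroup W₂] [Module R W₂]
    (F : V₁ ⊗[R] W₁ →ₗ[R] V₂ ⊗[R] W₂) (w : W₁) (φ : Module.Dual R W₂) (v : V₁) :
    tensorContract F w φ v = TensorProduct.rid R V₂ (φ.lTensor V₂ (F (v ⊗ₜ[R] w))) := rfl

/-- Contractions commute with operators acting on the left tensor factors only. -/
theorem tensorContract_comp {R V₁ V₂ W₁ W₂ : Type*} [Field R]
    [AddCommGroup V₁] [Module R V₁] [AddCommGroup V₂] [Module R V₂]
    [AddCommGroup W₁] [Module R W₁] [AddCommGroup W₂] [Module R W₂]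
    {F : V₁ ⊗[R] W₁ →ₗ[R] V₂ ⊗[R] W₂} {A : V₁ →ₗ[R] V₁} {B : V₂ →ₗ[R] V₂}
    (h : F ∘ₗ A.rTensor W₁ = B.rTensor W₂ ∘ₗ F) (w : W₁) (φ : Module.Dual R W₂) :
    tensorContract F w φ ∘ₗ A = B ∘ₗ tensorContract F w φ := by
  ext v
  have hv := LinearMap.congr_fun h (v ⊗ₜ[R] w)
  have comm : ∀ u : V₂ ⊗[R] W₂, TensorProduct.rid R V₂ (φ.lTensor V₂ (B.rTensor W₂ u)) =
      B (TensorProduct.rid R V₂ (φ.lTensor V₂ u)) := by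
    intro u
    induction u with
    | zero => simp
    | tmul x y => simp
    | add x y hx hy => simp only [map_add, hx, hy]
  simp only [LinearMap.comp_apply, LinearMap.rTensor_tmul] at hv
  simp only [LinearMap.comp_apply, tensorContract_apply, hv, comm]

/-- If all contractions of `F` are multiples of a nonzero `S`, then `F = S ⊗ T` for some `T`. -/
theorem exists_eq_tensorMap {R V₁ V₂ W₁ W₂ : Type*} [Field R]
    [AddCommGroup V₁] [Module R V₁] [AddCommGroup V₂] [Module R V₂]
    [AddCommGroup W₁] [Module R W₁] [AddCommGroup W₂] [Module R W₂] [FiniteDimensional R W₂]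
    {S : V₁ →ₗ[R] V₂} (hS : S ≠ 0) {F : V₁ ⊗[R] W₁ →ₗ[R] V₂ ⊗[R] W₂}
    (hF : ∀ w φ, ∃ c : R, tensorContract F w φ = c • S) :
    ∃ T : W₁ →ₗ[R] W₂, F = TensorProduct.map S T := by
  obtain ⟨v₀, hv₀⟩ := DFunLike.ne_iff.mp hS
  obtain ⟨ψ, hψ⟩ := Module.Projective.exists_dual_eq_one R hv₀
  let T : W₁ →ₗ[R] W₂ :=
    (TensorProduct.lid R W₂).toLinearMap ∘ₗ ψ.rTensor W₂ ∘ₗ F ∘ₗ TensorProduct.mk R V₁ W₁ v₀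
  refine ⟨T, TensorProduct.ext' fun v w => tensor_ext_of_lTensor_dual fun φ => ?_⟩
  apply (TensorProduct.rid R V₂).injective
  obtain ⟨c, hc⟩ := hF w φ
  have swap : ∀ u : V₂ ⊗[R] W₂, φ (TensorProduct.lid R W₂ (ψ.rTensor W₂ u)) =
      ψ (TensorProduct.rid R V₂ (φ.lTensor V₂ u)) := by
    intro u
    induction u with
    | zero => simp
    | tmul x y => simp [mul_comm]
    | add x y hx hy => simp only [map_add, hx, hy]
  have hT : φ (T w) = c := by
    change φ (TensorProduct.lid R W₂ (ψ.rTensor W₂ (F (v₀ ⊗ₜ[R] w)))) = c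
    rw [swap, ← tensorContract_apply, hc]
    simp [hψ]
  rw [← tensorContract_apply, hc]
  simp [hT]

/-- Suppose `Hom_{X₁∩X₂}(μ₁, μ₂) = Hom_{X₁¹∩X₂¹}(μ₁, μ₂)` is
one-dimensional and `ζᵢ` is trivial on `Xᵢ¹`.  Then for any nonzero
`S ∈ Hom_{X₁∩X₂}(μ₁, μ₂)`, the map `T ↦ S ⊗ T` is an `R`-linear isomorphism from
`Hom_{X₁∩X₂}(ζ₁, ζ₂)` onto `Hom_{X₁∩X₂}(μ₁ ⊗ ζ₁, μ₂ ⊗ ζ₂)`. -/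
theorem tensor_intertwiner_iso
    {R G : Type*} [Field R] [Group G]
    (X₁ X₂ X₁' X₂' : Subgroup G) (h1 : X₁' ≤ X₁) (h2 : X₂' ≤ X₂)
    {V₁ V₂ W₁ W₂ : Type*}
    [AddCommGroup V₁] [Module R V₁] [FiniteDimensional R V₁]
    [AddCommGroup V₂] [Module R V₂] [FiniteDimensional R V₂]
    [AddCommGroup W₁] [Module R W₁] [FiniteDimensional R W₁]
    [AddCommGroup W₂] [Module R W₂] [FiniteDimensional R W₂]
    (μ₁ : Representation R (↥X₁) V₁) (μ₂ : Representation R (↥X₂) V₂)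
    (ζ₁ : Representation R (↥X₁) W₁) (ζ₂ : Representation R (↥X₂) W₂)
    (hζ₁ : ∀ x (hx : x ∈ X₁'), ζ₁ ⟨x, h1 hx⟩ = LinearMap.id)
    (hζ₂ : ∀ x (hx : x ∈ X₂'), ζ₂ ⟨x, h2 hx⟩ = LinearMap.id)
    (hEq : intertwiners μ₁ μ₂ ((X₁ ⊓ X₂ : Subgroup G) : Set G)
        (fun x hx => (Subgroup.mem_inf.mp hx).1) (fun x hx => (Subgroup.mem_inf.mp hx).2) =
      intertwiners μ₁ μ₂ ((X₁' ⊓ X₂' : Subgroup G) : Set G)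
        (fun x hx => h1 (Subgroup.mem_inf.mp hx).1) (fun x hx => h2 (Subgroup.mem_inf.mp hx).2))
    (hdim : ∃ f₀ ∈ intertwiners μ₁ μ₂ ((X₁ ⊓ X₂ : Subgroup G) : Set G)
        (fun x hx => (Subgroup.mem_inf.mp hx).1) (fun x hx => (Subgroup.mem_inf.mp hx).2),
      f₀ ≠ 0 ∧ ∀ f ∈ intertwiners μ₁ μ₂ ((X₁ ⊓ X₂ : Subgroup G) : Set G)
        (fun x hx => (Subgroup.mem_inf.mp hx).1) (fun x hx => (Subgroup.mem_inf.mp hx).2),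
        ∃ c : R, f = c • f₀)
    (S : V₁ →ₗ[R] V₂)
    (hS : S ∈ intertwiners μ₁ μ₂ ((X₁ ⊓ X₂ : Subgroup G) : Set G)
        (fun x hx => (Subgroup.mem_inf.mp hx).1) (fun x hx => (Subgroup.mem_inf.mp hx).2))
    (hS0 : S ≠ 0) :
    (∀ T T' : W₁ →ₗ[R] W₂,
        TensorProduct.map S (T + T') = TensorProduct.map S T + TensorProduct.map S T') ∧
    (∀ (c : R) (T : W₁ →ₗ[R] W₂),
        TensorProduct.map S (c • T) = c • TensorProduct.map S T) ∧
    Set.BijOn (fun T : W₁ →ₗ[R] W₂ => TensorProduct.map S T)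
      (intertwiners ζ₁ ζ₂ ((X₁ ⊓ X₂ : Subgroup G) : Set G)
        (fun x hx => (Subgroup.mem_inf.mp hx).1) (fun x hx => (Subgroup.mem_inf.mp hx).2))
      (intertwiners (μ₁.tprod ζ₁) (μ₂.tprod ζ₂) ((X₁ ⊓ X₂ : Subgroup G) : Set G)
        (fun x hx => (Subgroup.mem_inf.mp hx).1) (fun x hx => (Subgroup.mem_inf.mp hx).2)) := by
  refine ⟨fun T T' => TensorProduct.map_add_right S T T',
    fun c T => TensorProduct.map_smul_right c S T, ?_, (tensorMap_right_injective hS0).injOn, ?_⟩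
  · intro T hT x hx
    rw [Representation.tprod_apply, Representation.tprod_apply, ← TensorProduct.map_comp,
      ← TensorProduct.map_comp, hS x hx, hT x hx]
  · intro F hF
    have contract_mem : ∀ w φ, ∃ c : R, tensorContract F w φ = c • S := by
      intro w φ
      obtain ⟨f₀, -, -, hspan⟩ := hdim
      obtain ⟨a, rfl⟩ := hspan S hS
      have ha : a ≠ 0 := by
        rintro rfl
        simp at hS0
      have hmem : tensorContract F w φ ∈ intertwiners μ₁ μ₂ ((X₁' ⊓ X₂' : Subgroup G) : Set G)
          (fun x hx => h1 (Subgroup.mem_inf.mp hx).1)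
          (fun x hx => h2 (Subgroup.mem_inf.mp hx).2) := by
        intro x hx
        obtain ⟨hx₁, hx₂⟩ := Subgroup.mem_inf.mp hx
        have hFx := hF x (Subgroup.mem_inf.mpr ⟨h1 hx₁, h2 hx₂⟩)
        rw [Representation.tprod_apply, Representation.tprod_apply, hζ₁ x hx₁, hζ₂ x hx₂] at hFx
        exact tensorContract_comp hFx w φ
      obtain ⟨c, hc⟩ := hspan _ (hEq ▸ hmem)
      exact ⟨c * a⁻¹, by rw [hc, smul_smul, inv_mul_cancel_right₀ ha]⟩
    obtain ⟨T, rfl⟩ := exists_eq_tensorMap hS0 contract_mem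
    refine ⟨T, fun x hx => ?_, rfl⟩
    have hx₂ := (Subgroup.mem_inf.mp hx).2
    have hFx := hF x hx
    rw [Representation.tprod_apply, Representation.tprod_apply, ← TensorProduct.map_comp,
      ← TensorProduct.map_comp, hS x hx] at hFx
    refine tensorMap_right_injective (fun h0 => hS0 ?_) hFx
    ext v
    apply (μ₂.apply_bijective ⟨x, hx₂⟩).injective
    simpa using LinearMap.congr_fun h0 v
end

section
/- Let G be a group, A a subgroup of G, Q₁ and Q₂ subgroups of A, and U₁ and U₂ subgroups of G such that Q₁ normalizes U₁ and Q₂ normalizes U₂; set K₁ = Q₁U₁ and K₂ = Q₂U₂ (these are subgroups of G). Assume that for every h ∈ A one has (U₂hU₁) ∩ A ⊆ Q₂hQ₁. Then the assignment sending the double coset Q₂aQ₁ (for a ∈ A) to the double coset K₂aK₁ is a well-defined bijection from the set of (Q₂, Q₁)-double cosets in A onto the set of (K₂, K₁)-double cosets in G that meet A. -/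
/-- The double coset `P x Q` of an element `x` with respect to two subgroups `P`, `Q`. -/
def doubleCosetOf {G : Type*} [Group G] (P Q : Subgroup G) (x : G) : Set G :=
  {z : G | ∃ p ∈ P, ∃ q ∈ Q, z = p * x * q}

theorem doubleCosetOf_eq_iff {G : Type*} [Group G] {P Q : Subgroup G} {x y : G} :
    doubleCosetOf P Q x = doubleCosetOf P Q y ↔ y ∈ doubleCosetOf P Q x := by
  have h (z : G) : doubleCosetOf P Q z = DoubleCoset.doubleCoset z P Q :=
    Set.ext fun _ => DoubleCoset.mem_doubleCoset.symm
  rw [h, h]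
  exact ⟨fun e => e ▸ DoubleCoset.mem_doubleCoset_self P Q y,
    fun hy => (DoubleCoset.doubleCoset_eq_of_mem hy).symm⟩

/-- If `Q₁, Q₂ ≤ A`, `Qᵢ` normalizes `Uᵢ`, `Kᵢ = QᵢUᵢ`, and for all `h ∈ A`
one has `(U₂hU₁) ∩ A ⊆ Q₂hQ₁`, then `Q₂aQ₁ ↦ K₂aK₁` is a well-defined bijection from the
`(Q₂, Q₁)`-double cosets in `A` onto the `(K₂, K₁)`-double cosets in `G` that meet `A`. -/
theorem doubleCoset_bijection
    {G : Type*} [Group G] (A Q₁ Q₂ U₁ U₂ K₁ K₂ : Subgroup G)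
    (hQ₁A : Q₁ ≤ A) (hQ₂A : Q₂ ≤ A)
    (hn₁ : ∀ q ∈ Q₁, ∀ u ∈ U₁, q * u * q⁻¹ ∈ U₁)
    (hn₂ : ∀ q ∈ Q₂, ∀ u ∈ U₂, q * u * q⁻¹ ∈ U₂)
    (hK₁ : (K₁ : Set G) = {x : G | ∃ q ∈ Q₁, ∃ u ∈ U₁, x = q * u})
    (hK₂ : (K₂ : Set G) = {x : G | ∃ q ∈ Q₂, ∃ u ∈ U₂, x = q * u})
    (hmain : ∀ h ∈ A, doubleCosetOf U₂ U₁ h ∩ (A : Set G) ⊆ doubleCosetOf Q₂ Q₁ h) :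
    (∀ a ∈ A, ∀ a' ∈ A,
        (doubleCosetOf Q₂ Q₁ a = doubleCosetOf Q₂ Q₁ a' ↔
          doubleCosetOf K₂ K₁ a = doubleCosetOf K₂ K₁ a')) ∧
    (∀ D : Set G, (∃ g : G, D = doubleCosetOf K₂ K₁ g) → (D ∩ (A : Set G)).Nonempty →
        ∃ a ∈ A, D = doubleCosetOf K₂ K₁ a) := by
  have mem₁ (x : G) : x ∈ K₁ ↔ ∃ q ∈ Q₁, ∃ u ∈ U₁, x = q * u := Set.ext_iff.mp hK₁ x
  have mem₂ (x : G) : x ∈ K₂ ↔ ∃ q ∈ Q₂, ∃ u ∈ U₂, x = q * u := Set.ext_iff.mp hK₂ x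
  refine ⟨fun a ha a' ha' => ?_, ?_⟩
  · rw [doubleCosetOf_eq_iff, doubleCosetOf_eq_iff]
    constructor
    · rintro ⟨p, hp, q, hq, rfl⟩
      exact ⟨p, (mem₂ p).mpr ⟨p, hp, 1, U₂.one_mem, (mul_one p).symm⟩,
        q, (mem₁ q).mpr ⟨q, hq, 1, U₁.one_mem, (mul_one q).symm⟩, rfl⟩
    · rintro ⟨k₂, hk₂, k₁, hk₁, rfl⟩
      obtain ⟨q₂, hq₂, u₂, hu₂, rfl⟩ := (mem₂ k₂).mp hk₂
      obtain ⟨q₁, hq₁, u₁, hu₁, rfl⟩ := (mem₁ k₁).mp hk₁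
      have hA : u₂ * a * (q₁ * u₁ * q₁⁻¹) ∈ A := by
        have h := A.mul_mem (A.mul_mem (A.inv_mem (hQ₂A hq₂)) ha') (A.inv_mem (hQ₁A hq₁))
        convert h using 1
        group
      obtain ⟨p, hp, q, hq, h⟩ := hmain a ha ⟨⟨u₂, hu₂, _, hn₁ q₁ hq₁ u₁ hu₁, rfl⟩, hA⟩
      refine ⟨q₂ * p, Q₂.mul_mem hq₂ hp, q * q₁, Q₁.mul_mem hq hq₁, ?_⟩
      calc q₂ * u₂ * a * (q₁ * u₁) = q₂ * (u₂ * a * (q₁ * u₁ * q₁⁻¹)) * q₁ := by group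
        _ = q₂ * p * a * (q * q₁) := by rw [h]; group
  · rintro D ⟨g, rfl⟩ ⟨a, hag, ha⟩
    exact ⟨a, ha, doubleCosetOf_eq_iff.mpr hag⟩
end
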